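/- arXiv:1605.03772 — 2 statements merged into one kernel-verified Lean document; each statement's English description precedes it below -/
import Mathlib

section
/- Correctness of XOR-accumulation of actions with disjoint projections: let π₁, …, π_k ∈ {0,1}ⁿ be projections that are pairwise disjoint (for i ≠ j, there is no position where both π_i and π_j equal 1), and let α₀⁽¹⁾, …, α₀⁽ᵏ⁾ ∈ {0,1}ⁿ satisfy ω(π_j, α₀⁽ʲ⁾) = α₀⁽ʲ⁾ for each j. Set β′ = π₁ ⊕ ⋯ ⊕ π_k and α′ = α₀⁽¹⁾ ⊕ ⋯ ⊕ α₀⁽ᵏ⁾. Then for every x ∈ {0,1}ⁿ, applying the k substring replacements (with actions α₀⁽¹⁾, …, α₀⁽ᵏ⁾ and projections π₁, …, π_k) sequentially to x yields the same result as the single merged replacement that sets x(i) to α′(i) at each position i with β′(i) = 1 and leaves x(i) unchanged otherwise. -/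
/-- A bitstring of length `n` is a function `Fin n → Bool`. -/
abbrev BitStr (n : ℕ) : Type := Fin n → Bool

/-- Componentwise XOR of two bitstrings. -/
def bxor {n : ℕ} (x y : BitStr n) : BitStr n := fun i => xor (x i) (y i)

/-- The masking `ω(π, x)`: keep `x i` where `π i = 1`, set `0` elsewhere. -/
def mask {n : ℕ} (π x : BitStr n) : BitStr n := fun i => if π i then x i else false

/-- Substring replacement with action `α₀` supported on projection `π`. -/
def replace {n : ℕ} (π α₀ : BitStr n) (x : BitStr n) : BitStr n :=
  fun i => if π i then α₀ i else x i

/-- XOR of a finite family of bitstrings: `f 0 ⊕ f 1 ⊕ ⋯ ⊕ f (k-1)`. -/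
def bigXor {n k : ℕ} (f : Fin k → BitStr n) : BitStr n :=
  (List.ofFn f).foldr bxor (fun _ => false)

theorem bigXor_succ_apply {n k : ℕ} (f : Fin (k + 1) → BitStr n) (p : Fin n) :
    bigXor f p = xor (f 0 p) (bigXor (fun j => f j.succ) p) := by
  simp [bigXor, bxor, List.ofFn_succ]

theorem bigXor_apply_eq_false {n k : ℕ} (f : Fin k → BitStr n) (p : Fin n)
    (hf : ∀ j, f j p = false) : bigXor f p = false := by
  induction k with
  | zero => simp [bigXor]
  | succ k ih => rw [bigXor_succ_apply, hf 0, ih _ fun j => hf j.succ, Bool.xor_false]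

theorem apply_eq_false_of_mask_eq_self {n : ℕ} {π α : BitStr n} (h : mask π α = α)
    {p : Fin n} (hp : π p = false) : α p = false := by
  rw [← h]
  simp [mask, hp]

/-- Correctness of XOR-accumulation of actions with pairwise disjoint
projections: if the projections `π 1, …, π k` are pairwise disjoint and each
action `α j` is supported on `π j`, then applying the `k` substring
replacements sequentially to a packet `x` yields the same result as the single
merged replacement with action `α′ = α 1 ⊕ ⋯ ⊕ α k` and projection
`β′ = π 1 ⊕ ⋯ ⊕ π k`. -/
theorem xor_accumulate_actions_correct (n k : ℕ)
    (π α : Fin k → BitStr n)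
    (hdisj : ∀ i j, i ≠ j → ∀ p, ¬(π i p = true ∧ π j p = true))
    (hsupp : ∀ j, mask (π j) (α j) = α j) (x : BitStr n) :
    (List.ofFn (fun j => replace (π j) (α j))).foldl (fun y g => g y) x =
      replace (bigXor π) (bigXor α) x := by
  induction k generalizing x with
  | zero =>
    funext p
    simp [bigXor, replace]
  | succ k ih =>
    rw [List.ofFn_succ, List.foldl_cons,
      ih (fun j => π j.succ) (fun j => α j.succ)
        (fun i j hij => hdisj _ _ ((Fin.succ_injective k).ne hij)) (fun j => hsupp j.succ)]
    funext p
    simp only [replace, bigXor_succ_apply]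
    cases h0 : π 0 p with
    | false => simp [apply_eq_false_of_mask_eq_self (hsupp 0) h0]
    | true =>
      have hπ : ∀ j : Fin k, π j.succ p = false := fun j =>
        Bool.eq_false_iff.mpr fun hj => hdisj 0 j.succ (Fin.succ_ne_zero j).symm p ⟨h0, hj⟩
      have hα : ∀ j : Fin k, α j.succ p = false := fun j =>
        apply_eq_false_of_mask_eq_self (hsupp j.succ) (hπ j)
      simp [bigXor_apply_eq_false _ p hπ, bigXor_apply_eq_false _ p hα]
end

section
/- Power-of-two range tests are substring matches: let n ≥ k ≥ 0 and let c < 2^{n−k} and x < 2ⁿ be natural numbers. Then the high n−k bits of x equal the binary representation of c — that is, x.testBit i = c.testBit (i − k) for every i with k ≤ i < n — if and only if c·2ᵏ ≤ x < (c+1)·2ᵏ. -/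
/-- Power-of-two range tests are substring matches: for `k ≤ n`, `c < 2^(n−k)`
and `x < 2ⁿ`, the high `n − k` bits of `x` equal the binary representation of
`c` (i.e. `x.testBit i = c.testBit (i − k)` for all `k ≤ i < n`) if and only
if `c·2ᵏ ≤ x < (c+1)·2ᵏ`. -/
theorem high_bits_match_iff_mem_pow_two_range (n k c x : ℕ)
    (hkn : k ≤ n) (hc : c < 2 ^ (n - k)) (hx : x < 2 ^ n) :
    (∀ i, k ≤ i → i < n → x.testBit i = c.testBit (i - k)) ↔
      (c * 2 ^ k ≤ x ∧ x < (c + 1) * 2 ^ k) := by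
  have range_iff : (c * 2 ^ k ≤ x ∧ x < (c + 1) * 2 ^ k) ↔ x / 2 ^ k = c := by
    rw [← Nat.le_div_iff_mul_le (by positivity), ← Nat.div_lt_iff_lt_mul (by positivity)]
    omega
  rw [range_iff]
  constructor
  · intro h
    refine Nat.eq_of_testBit_eq fun j => ?_
    rw [Nat.testBit_div_two_pow]
    by_cases hj : j + k < n
    · simpa using h (j + k) (Nat.le_add_left k j) hj
    · rw [Nat.testBit_lt_two_pow (hx.trans_le (Nat.pow_le_pow_right two_pos (by omega))),
        Nat.testBit_lt_two_pow (hc.trans_le (Nat.pow_le_pow_right two_pos (by omega)))]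
  · rintro rfl i hki -
    rw [Nat.testBit_div_two_pow, Nat.sub_add_cancel hki]
end
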